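/- Let K=(S,AP,→,L) be a Kripke structure, π a cycle-free partition of S, and 𝐁 a union of some of the blocks of π. Then π is unstable under 𝐁 if and only if there is a block B' ∈ π such that ∅ ⊊ split(B',𝐁) and bottom(B') ∩ split(B',𝐁) ⊊ bottom(B') (both inclusions strict). -/

import Mathlib

/-- A Kripke structure: states, atomic propositions, a total transition
relation and a state labelling. -/
structure Kripke (S AP : Type*) where
  tr : S → S → Prop
  L : S → Set AP
  total : ∀ s : S, ∃ t : S, tr s t

variable {S AP : Type*}

/-- `R` is a divergence-blind stuttering equivalence. -/
def IsDBS (K : Kripke S AP) (R : S → S → Prop) : Prop :=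
  Symmetric R ∧ ∀ s t, R s t →
    K.L s = K.L t ∧
    ∀ s', K.tr s s' → ∃ (k : ℕ) (f : ℕ → S), f 0 = t ∧
      (∀ i < k, K.tr (f i) (f (i + 1))) ∧
      (∀ i < k, R s (f i)) ∧ R s' (f k)

/-- Divergence-blind stuttering equivalence of two states. -/
def DBSEq (K : Kripke S AP) (s t : S) : Prop :=
  ∃ R, IsDBS K R ∧ R s t

/-- `π` is a partition of the set of all states. -/
def IsPartition (π : Set (Set S)) : Prop :=
  (∀ B ∈ π, B.Nonempty) ∧
  (∀ B ∈ π, ∀ B' ∈ π, B ≠ B' → B ∩ B' = ∅) ∧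
  ⋃₀ π = Set.univ

/-- `split C Bu`: the states in `C` from which a path inside `C` reaches `Bu`. -/
def split (K : Kripke S AP) (C Bu : Set S) : Set S :=
  {s ∈ C | ∃ (k : ℕ) (f : ℕ → S), f 0 = s ∧
    (∀ i < k, K.tr (f i) (f (i + 1))) ∧ (∀ i < k, f i ∈ C) ∧ f k ∈ Bu}

def cosplit (K : Kripke S AP) (C Bu : Set S) : Set S :=
  C \ split K C Bu

/-- A block `C` is unstable under `Bu` iff both `split` and `cosplit` are nonempty. -/
def Unstable (K : Kripke S AP) (C Bu : Set S) : Prop :=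
  (split K C Bu).Nonempty ∧ (cosplit K C Bu).Nonempty

/-- The bottom states of a block: no outgoing transition inside the block. -/
def bottom (K : Kripke S AP) (B : Set S) : Set S :=
  {s ∈ B | ∀ s' ∈ B, ¬ K.tr s s'}

/-- A partition is cycle-free: no block contains a cycle staying inside it. -/
def CycleFree (K : Kripke S AP) (π : Set (Set S)) : Prop :=
  ¬ ∃ B ∈ π, ∃ (k : ℕ) (f : ℕ → S),
    (∀ i ≤ k, f i ∈ B) ∧ (∀ i < k, K.tr (f i) (f (i + 1))) ∧ K.tr (f k) (f 0)

/-- `π` respects divergence-blind stuttering equivalence. -/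
def Respects (K : Kripke S AP) (π : Set (Set S)) : Prop :=
  ∀ s t, DBSEq K s t → ∃ B ∈ π, s ∈ B ∧ t ∈ B

/-- The refinement of `π` under `Bu`: every unstable block is replaced by
its `split` and `cosplit` parts. -/
def refinement (K : Kripke S AP) (π : Set (Set S)) (Bu : Set S) : Set (Set S) :=
  {B ∈ π | ¬ Unstable K B Bu} ∪
  {C | ∃ B' ∈ π, Unstable K B' Bu ∧ (C = split K B' Bu ∨ C = cosplit K B' Bu)}

/-- A state of `C` with a successor in `split K C Bu` is itself in `split K C Bu`. -/
theorem mem_split_of_tr {K : Kripke S AP} {C Bu : Set S} {s t : S} (hs : s ∈ C)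
    (hst : K.tr s t) (ht : t ∈ split K C Bu) : s ∈ split K C Bu := by
  obtain ⟨-, k, f, rfl, htr, hC, hk⟩ := ht
  refine ⟨hs, k + 1, fun n => Nat.casesOn n s f, rfl, ?_, ?_, hk⟩
  · rintro (_ | i) hi
    · exact hst
    · exact htr i (by omega)
  · rintro (_ | i) hi
    · exact hs
    · exact hC i (by omega)

/-- In a finite cycle-free partition, a nonempty subset of a block contains a state
without successors in that subset. -/
theorem CycleFree.exists_forall_not_tr [Finite S] {K : Kripke S AP} {π : Set (Set S)}
    (hcf : CycleFree K π) {B C : Set S} (hB : B ∈ π) (hCB : C ⊆ B) (hC : C.Nonempty) :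
    ∃ s ∈ C, ∀ t ∈ C, ¬ K.tr s t := by
  by_contra! h
  choose! next hnext htr using h
  obtain ⟨s, hs⟩ := hC
  let g : ℕ → S := fun n => next^[n] s
  have hsucc : ∀ n, g (n + 1) = next (g n) := fun n => Function.iterate_succ_apply' next n s
  have hg : ∀ n, g n ∈ C := by
    intro n
    induction n with
    | zero => exact hs
    | succ n ih => rw [hsucc]; exact hnext _ ih
  have hgtr : ∀ n, K.tr (g n) (g (n + 1)) := fun n => by rw [hsucc]; exact htr _ (hg n)
  obtain ⟨a, b, hab, heq⟩ : ∃ a b, a < b ∧ g a = g b := by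
    obtain ⟨a, b, hne, heq⟩ := Finite.exists_ne_map_eq_of_infinite g
    rcases lt_or_gt_of_ne hne with h | h
    · exact ⟨a, b, h, heq⟩
    · exact ⟨b, a, h, heq.symm⟩
  obtain ⟨k, rfl⟩ := Nat.exists_eq_add_of_lt hab
  refine hcf ⟨B, hB, k, fun i => g (a + i), fun i _ => hCB (hg _), fun i _ => hgtr _, ?_⟩
  change K.tr (g (a + k)) (g a)
  rw [heq]
  exact hgtr _

/-- For a cycle-free partition `π` and a union `⋃₀ σ` of some of its blocks,
`π` is unstable under `⋃₀ σ` iff some block `B'` has a nonempty `split` whose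
intersection with the bottom states of `B'` is a strict subset of those bottom
states. -/
theorem unstable_iff_bottom [Fintype S] [Fintype AP]
    (K : Kripke S AP) (π : Set (Set S))
    (hpart : IsPartition π)
    (hcf : CycleFree K π)
    (σ : Set (Set S)) (hσ : σ ⊆ π) :
    (∃ B' ∈ π, Unstable K B' (⋃₀ σ)) ↔
      ∃ B' ∈ π, ∅ ⊂ split K B' (⋃₀ σ) ∧
        bottom K B' ∩ split K B' (⋃₀ σ) ⊂ bottom K B' := by
  constructor
  · rintro ⟨B, hB, hsplit, hcosplit⟩
    refine ⟨B, hB, Set.empty_ssubset.2 hsplit, Set.inter_subset_left, fun hsub => ?_⟩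
    obtain ⟨s, hs, hmax⟩ := hcf.exists_forall_not_tr hB Set.sdiff_subset hcosplit
    refine hs.2 (hsub ⟨hs.1, fun t ht hst => hmax t ⟨ht, fun htsplit => ?_⟩ hst⟩).2
    exact hs.2 (mem_split_of_tr hs.1 hst htsplit)
  · rintro ⟨B, hB, hsplit, hbot⟩
    obtain ⟨s, hs, hns⟩ := Set.exists_of_ssubset hbot
    exact ⟨B, hB, Set.empty_ssubset.1 hsplit, s, hs.1, fun h => hns ⟨hs, h⟩⟩
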